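/- There exist a constant c > 0 and an integer n₀ such that for every n ≥ n₀ there exists a transitive DFA with n states and a subset S of its state set such that S is synchronized by some word and the shortest word synchronizing S has length at least c · 2^{n/2} / √n. -/

import Mathlib

/-- Action of a DFA transition function on a subset of states along a word. -/
def dfaRun {n m : ℕ} (δ : Fin n → Fin m → Fin n) :
    Finset (Fin n) → List (Fin m) → Finset (Fin n)
  | S, [] => S
  | S, a :: w => dfaRun δ (S.image fun q => δ q a) w

/-- A word `w` synchronizes the subset `S` in the DFA `δ`. -/
def dfaSync {n m : ℕ} (δ : Fin n → Fin m → Fin n) (S : Finset (Fin n))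
    (w : List (Fin m)) : Prop :=
  (dfaRun δ S w).card = 1

/-- A DFA is transitive if every state can be sent to every other state by some word. -/
def dfaTransitive {n m : ℕ} (δ : Fin n → Fin m → Fin n) : Prop :=
  ∀ q q' : Fin n, ∃ w, dfaRun δ {q} w = {q'}

theorem dfaRun_append {n m : ℕ} (δ : Fin n → Fin m → Fin n) (S : Finset (Fin n))
    (u v : List (Fin m)) : dfaRun δ S (u ++ v) = dfaRun δ (dfaRun δ S u) v := by
  induction u generalizing S with
  | nil => rfl
  | cons a u ih => exact ih _

/-- The state `q'` is reachable from `q`. -/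
def DfaReach {n m : ℕ} (δ : Fin n → Fin m → Fin n) (q q' : Fin n) : Prop :=
  ∃ w, dfaRun δ {q} w = {q'}

theorem DfaReach.trans {n m : ℕ} {δ : Fin n → Fin m → Fin n} {p q r : Fin n}
    (h₁ : DfaReach δ p q) (h₂ : DfaReach δ q r) : DfaReach δ p r := by
  obtain ⟨u, hu⟩ := h₁
  obtain ⟨v, hv⟩ := h₂
  exact ⟨u ++ v, by rw [dfaRun_append, hu, hv]⟩

/-- Any set of self-maps of `Fin n` is the set of letter actions of some DFA. -/
theorem exists_dfa_of_maps {n : ℕ} (L : Set (Fin n → Fin n)) :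
    ∃ (m : ℕ) (δ : Fin n → Fin m → Fin n),
      (∀ a, (fun q => δ q a) ∈ L) ∧ ∀ h ∈ L, ∃ a, (fun q => δ q a) = h := by
  classical
  refine ⟨Fintype.card L, fun q a => ((Fintype.equivFin L).symm a).1 q, fun a => ?_, fun h hh => ?_⟩
  · exact ((Fintype.equivFin L).symm a).2
  · exact ⟨Fintype.equivFin L ⟨h, hh⟩, by simp⟩

/-! ### Lifting letters along a map with a section -/

/-- The self-maps of `Q` which descend along `π` to a map in `G`. -/
def liftMaps {Q P : Type*} (π : Q → P) (G : Set (P → P)) : Set (Q → Q) :=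
  {h | ∃ g ∈ G, ∀ q, π (h q) = g (π q)}

theorem section_comp_mem_liftMaps {Q P : Type*} {π : Q → P} {s : P → Q}
    (hs : ∀ p, π (s p) = p) {G : Set (P → P)} {g : P → P} (hg : g ∈ G) :
    (fun q => s (g (π q))) ∈ liftMaps π G :=
  ⟨g, hg, fun _ => hs _⟩

theorem dfaReach_of_map {n m : ℕ} {δ : Fin n → Fin m → Fin n} {P : Type*} {π : Fin n → P}
    {s : P → Fin n} (hs : ∀ p, π (s p) = p) {G : Set (P → P)}
    (hδ : ∀ h ∈ liftMaps π G, ∃ a, (fun q => δ q a) = h) {g : P → P} (hg : g ∈ G)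
    {q q' : Fin n} (hq : π q' = g (π q)) : DfaReach δ q q' := by
  obtain ⟨a, ha⟩ := hδ (fun y => if y = q then q' else s (g (π y))) ⟨g, hg, fun y => by
    by_cases hy : y = q
    · simp [hy, hq]
    · simp [hy, hs]⟩
  exact ⟨[a], by simpa [dfaRun] using congrFun ha q⟩

/-! ### The letters

The state `(none, e)` is a marker and `(some x, e)` a token at `x`, with sign `e`. Every letter
commutes with the sign change, so two states that differ only in sign never merge. -/

/-- Tokens outside `A` become a marker of opposite sign, tokens in `A` are moved by `f`. -/
def checkLetter {α : Type*} [DecidableEq α] (A : Finset α) (f : α → Option α) :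
    Option α × Bool → Option α × Bool
  | (none, e) => (none, e)
  | (some x, e) => if x ∈ A then (f x, e) else (none, !e)

/-- The marker becomes a token at `x`, every token becomes a token at `x` of opposite sign. -/
def spawnLetter {α : Type*} (x : α) : Option α × Bool → Option α × Bool
  | (none, e) => (some x, e)
  | (some _, e) => (some x, !e)

/-- The letters that lead through the sets `B 0, …, B (M - 1)` and finally merge `B (M - 1)` with
the marker, together with the spawning letters. -/
inductive ChainLetter {α : Type*} [DecidableEq α] (M : ℕ) (B : ℕ → Finset α) (f : ℕ → α → α) :
    (Option α × Bool → Option α × Bool) → Prop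
  | advance (i : ℕ) (hi : i + 1 < M) : ChainLetter M B f (checkLetter (B i) fun x => some (f i x))
  | merge (i : ℕ) (hi : i + 1 = M) : ChainLetter M B f (checkLetter (B i) fun _ => none)
  | spawn (x : α) : ChainLetter M B f (spawnLetter x)

section Chain

variable {α : Type*} [DecidableEq α] {M : ℕ} {B : ℕ → Finset α} {f : ℕ → α → α}

theorem ChainLetter.map_not {g : Option α × Bool → Option α × Bool} (hg : ChainLetter M B f g)
    (p : Option α) (e : Bool) : g (p, !e) = ((g (p, e)).1, !(g (p, e)).2) := by
  cases hg <;> rcases p with _ | x <;> simp only [checkLetter, spawnLetter] <;> split_ifs <;> rfl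

variable {n m : ℕ} {δ : Fin n → Fin m → Fin n} {π : Fin n → Option α × Bool}

theorem not_dfaSync_of_opposite_signs
    (hδ : ∀ a, (fun q => δ q a) ∈ liftMaps π {g | ChainLetter M B f g})
    (w : List (Fin m)) (T : Finset (Fin n)) (p : Option α) (e : Bool)
    (h₁ : (p, e) ∈ T.image π) (h₂ : (p, !e) ∈ T.image π) : ¬ dfaSync δ T w := by
  induction w generalizing T p e with
  | nil =>
    intro h
    obtain ⟨q, hq⟩ := Finset.card_eq_one.1 (show T.card = 1 from h)
    subst hq
    simp only [Finset.image_singleton, Finset.mem_singleton] at h₁ h₂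
    have := h₁.trans h₂.symm
    simp at this
  | cons a w ih =>
    obtain ⟨g, hg, hπ⟩ := hδ a
    obtain ⟨q₁, hq₁, e₁⟩ := Finset.mem_image.1 h₁
    obtain ⟨q₂, hq₂, e₂⟩ := Finset.mem_image.1 h₂
    refine ih (T.image fun q => δ q a) (g (p, e)).1 (g (p, e)).2 ?_ ?_
    · exact Finset.mem_image.2 ⟨δ q₁ a, Finset.mem_image_of_mem _ hq₁, by rw [hπ, e₁]⟩
    · exact Finset.mem_image.2 ⟨δ q₂ a, Finset.mem_image_of_mem _ hq₂, by
        rw [hπ, e₂, ChainLetter.map_not hg]⟩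

theorem le_length_of_dfaSync {k : ℕ} (hk : 0 < k)
    (hδ : ∀ a, (fun q => δ q a) ∈ liftMaps π {g | ChainLetter M B f g})
    (hcard : ∀ i, (B i).card = k) (hinj : ∀ i < M, ∀ j < M, B i = B j → i = j)
    (hf : ∀ i, (B i).image (f i) = B (i + 1)) (w : List (Fin m)) (T : Finset (Fin n)) (i : ℕ)
    (hi : i < M) (h₀ : (none, false) ∈ T.image π)
    (hB : ∀ x ∈ B i, (some x, false) ∈ T.image π) (hw : dfaSync δ T w) : M ≤ i + w.length := by
  induction w generalizing T i with
  | nil =>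
    obtain ⟨x, hx⟩ := Finset.card_pos.1 (hk.trans_eq (hcard i).symm)
    obtain ⟨q, hq⟩ := Finset.card_eq_one.1 (show T.card = 1 from hw)
    subst hq
    have h₁ := hB x hx
    simp only [Finset.image_singleton, Finset.mem_singleton] at h₀ h₁
    have := h₀.trans h₁.symm
    simp at this
  | cons a w ih =>
    obtain ⟨g, hg, hπ⟩ := hδ a
    have himage : ∀ p ∈ T.image π, g p ∈ (T.image fun q => δ q a).image π := by
      intro p hp
      obtain ⟨q, hq, rfl⟩ := Finset.mem_image.1 hp
      exact Finset.mem_image.2 ⟨δ q a, Finset.mem_image_of_mem _ hq, hπ q⟩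
    have hdead := not_dfaSync_of_opposite_signs hδ w (T.image fun q => δ q a)
    have hoff : ∀ j < M, i ≠ j → ∃ x ∈ B i, x ∉ B j := by
      intro j hj hij
      by_contra! hsub
      exact hij (hinj i hi j hj (Finset.eq_of_subset_of_card_le hsub (by rw [hcard, hcard])))
    have h₁ := himage _ h₀
    cases hg with
    | advance j hj =>
      by_cases hij : i = j
      · subst hij
        have := ih (T.image fun q => δ q a) (i + 1) hj h₁ (fun y hy => by
          rw [← hf i] at hy
          obtain ⟨x, hx, rfl⟩ := Finset.mem_image.1 hy
          simpa [checkLetter, hx] using himage _ (hB x hx)) hw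
        simp only [List.length_cons]
        lia
      · obtain ⟨x, hx, hxj⟩ := hoff j (by lia) hij
        refine absurd hw (hdead none false h₁ ?_)
        simpa [checkLetter, hxj] using himage _ (hB x hx)
    | merge j hj =>
      by_cases hij : i = j
      · simp only [List.length_cons]
        lia
      · obtain ⟨x, hx, hxj⟩ := hoff j (by lia) hij
        refine absurd hw (hdead none false h₁ ?_)
        simpa [checkLetter, hxj] using himage _ (hB x hx)
    | spawn y =>
      obtain ⟨x, hx⟩ := Finset.card_pos.1 (hk.trans_eq (hcard i).symm)
      exact absurd hw (hdead (some y) false h₁ (himage _ (hB x hx)))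

variable {s : Option α × Bool → Fin n}

theorem exists_dfaSync (hs : ∀ p, π (s p) = p)
    (hδ : ∀ h ∈ liftMaps π {g | ChainLetter M B f g}, ∃ a, (fun q => δ q a) = h)
    (hf : ∀ i, (B i).image (f i) = B (i + 1)) (d i : ℕ) (hi : i + d + 1 = M)
    (T : Finset (Fin n)) (hT : T.Nonempty)
    (hB : ∀ q ∈ T, π q = (none, false) ∨ ∃ x ∈ B i, π q = (some x, false)) :
    ∃ w, dfaSync δ T w := by
  induction d generalizing i T with
  | zero =>
    obtain ⟨a, ha⟩ := hδ _ (section_comp_mem_liftMaps hs (ChainLetter.merge i hi))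
    refine ⟨[a], Finset.card_eq_one.2 ⟨s (none, false), ?_⟩⟩
    change T.image (fun q => δ q a) = _
    rw [ha]
    refine (Finset.image_congr fun q hq => ?_).trans (Finset.image_const hT _)
    rcases hB q hq with h | ⟨x, hx, h⟩
    · simp [h, checkLetter]
    · simp [h, checkLetter, hx]
  | succ d ih =>
    obtain ⟨a, ha⟩ := hδ _ (section_comp_mem_liftMaps hs
      (ChainLetter.advance (B := B) (f := f) i (by lia : i + 1 < M)))
    obtain ⟨w, hw⟩ := ih (i + 1) (by lia) (T.image fun q => δ q a) (hT.image _) (by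
      rw [ha]
      intro q' hq'
      obtain ⟨q, hq, rfl⟩ := Finset.mem_image.1 hq'
      rcases hB q hq with h | ⟨x, hx, h⟩
      · simp [h, checkLetter, hs]
      · refine Or.inr ⟨f i x, ?_, ?_⟩
        · rw [← hf i]
          exact Finset.mem_image_of_mem _ hx
        · simp [h, checkLetter, hs, hx])
    exact ⟨a :: w, hw⟩

theorem dfaTransitive_of_chainLetter (hs : ∀ p, π (s p) = p)
    (hδ : ∀ h ∈ liftMaps π {g | ChainLetter M B f g}, ∃ a, (fun q => δ q a) = h)
    {i : ℕ} (hi : i + 1 = M) {y z : α} (hy : y ∈ B i) (hz : z ∉ B i) : dfaTransitive δ := by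
  have spawn : ∀ q q' x e, π q = (none, e) → π q' = (some x, e) → DfaReach δ q q' := by
    intro q q' x e hq hq'
    exact dfaReach_of_map hs hδ (ChainLetter.spawn x) (by rw [hq, hq', spawnLetter])
  have merge : ∀ q q' x e, π q = (some x, e) → π q' = (none, if x ∈ B i then e else !e) →
      DfaReach δ q q' := by
    intro q q' x e hq hq'
    refine dfaReach_of_map hs hδ (ChainLetter.merge i hi) ?_
    rw [hq, hq', checkLetter]
    split_ifs <;> rfl
  have marker : ∀ q q' e e', π q = (none, e) → π q' = (none, e') → DfaReach δ q q' := by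
    intro q q' e e' hq hq'
    by_cases he : e' = e
    · exact (spawn q (s (some y, e)) y e hq (hs _)).trans
        (merge _ q' y e (hs _) (by rw [hq', if_pos hy, he]))
    · exact (spawn q (s (some z, e)) z e hq (hs _)).trans
        (merge _ q' z e (hs _) (by rw [hq', if_neg hz, Bool.eq_not.2 he]))
  have fromMarker : ∀ q q' e, π q = (none, e) → DfaReach δ q q' := by
    intro q q' e hq
    rcases hq' : π q' with ⟨_ | x, e'⟩
    · exact marker q q' e e' hq hq'
    · exact (marker q (s (none, e')) e e' hq (hs _)).trans (spawn _ q' x e' (hs _) hq')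
  intro q q'
  rcases hq : π q with ⟨_ | x, e⟩
  · exact fromMarker q q' e hq
  · exact (merge q (s (none, if x ∈ B i then e else !e)) x e hq (hs _)).trans
      (fromMarker _ q' _ (hs _))

end Chain

/-! ### Enumerating the middle layer -/

theorem exists_enumeration_powersetCard (N k : ℕ) (hk : k ≤ N) :
    ∃ (B : ℕ → Finset (Fin N)) (f : ℕ → Fin N → Fin N), (∀ i, (B i).card = k) ∧
      (∀ i < N.choose k, ∀ j < N.choose k, B i = B j → i = j) ∧
      ∀ i, (B i).image (f i) = B (i + 1) := by
  classical
  have hpos : 0 < N.choose k := Nat.choose_pos hk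
  have hc : (Finset.powersetCard k (Finset.univ : Finset (Fin N))).card = N.choose k := by simp
  let E := (Finset.powersetCard k (Finset.univ : Finset (Fin N))).equivFinOfCardEq hc
  let B : ℕ → Finset (Fin N) := fun i => (E.symm ⟨i % N.choose k, Nat.mod_lt _ hpos⟩).1
  have hcard : ∀ i, (B i).card = k := fun i =>
    (Finset.mem_powersetCard.1 (E.symm ⟨i % N.choose k, Nat.mod_lt _ hpos⟩).2).2
  have hf : ∀ i, ∃ f : Fin N → Fin N, (B i).image f = B (i + 1) := by
    intro i
    let e := Finset.equivOfCardEq ((hcard i).trans (hcard (i + 1)).symm)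
    refine ⟨fun x => if hx : x ∈ B i then e ⟨x, hx⟩ else x, ?_⟩
    ext y
    simp only [Finset.mem_image]
    constructor
    · rintro ⟨x, hx, rfl⟩
      simp [hx]
    · intro hy
      exact ⟨e.symm ⟨y, hy⟩, (e.symm ⟨y, hy⟩).2, by simp⟩
  choose f hf using hf
  refine ⟨B, f, hcard, fun i hi j hj hij => ?_, hf⟩
  have := E.symm.injective (Subtype.ext hij)
  simpa [Nat.mod_eq_of_lt hi, Nat.mod_eq_of_lt hj] using this

theorem sixteen_pow_le_mul_centralBinom_sq (k : ℕ) (hk : 1 ≤ k) :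
    16 ^ k ≤ 4 * k * k.centralBinom ^ 2 := by
  induction k, hk using Nat.le_induction with
  | base => simp [Nat.centralBinom, Nat.choose]
  | succ k hk ih =>
    have h := Nat.succ_mul_centralBinom_succ k
    refine Nat.le_of_mul_le_mul_left ?_ (Nat.succ_pos k)
    calc (k + 1) * 16 ^ (k + 1) = 16 * (k + 1) * 16 ^ k := by ring
      _ ≤ 16 * (k + 1) * (4 * k * k.centralBinom ^ 2) := Nat.mul_le_mul_left _ ih
      _ = 16 * (4 * k * (k + 1)) * k.centralBinom ^ 2 := by ring
      _ ≤ 16 * (2 * k + 1) ^ 2 * k.centralBinom ^ 2 := by gcongr; lia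
      _ = 4 * (2 * (2 * k + 1) * k.centralBinom) ^ 2 := by ring
      _ = 4 * ((k + 1) * (k + 1).centralBinom) ^ 2 := by rw [h]
      _ = (k + 1) * (4 * (k + 1) * (k + 1).centralBinom ^ 2) := by ring

theorem two_rpow_half_div_sqrt_le_centralBinom {n k : ℕ} (hk : 1 ≤ k) (hkn : k ≤ n)
    (hn : n ≤ 4 * k + 5) :
    1 / 16 * (2 : ℝ) ^ ((n : ℝ) / 2) / Real.sqrt n ≤ k.centralBinom := by
  have hn0 : (0 : ℝ) < n := by exact_mod_cast hk.trans hkn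
  have key : 2 ^ n ≤ 256 * k.centralBinom ^ 2 * n :=
    calc 2 ^ n ≤ 2 ^ (4 * k + 5) := Nat.pow_le_pow_right (by norm_num) hn
      _ = 32 * 16 ^ k := by rw [pow_add, pow_mul]; norm_num [mul_comm]
      _ ≤ 32 * (4 * k * k.centralBinom ^ 2) :=
        Nat.mul_le_mul_left _ (sixteen_pow_le_mul_centralBinom_sq k hk)
      _ = 128 * k.centralBinom ^ 2 * k := by ring
      _ ≤ 256 * k.centralBinom ^ 2 * n := by gcongr; norm_num
  have key' : (2 : ℝ) ^ n ≤ 256 * (k.centralBinom : ℝ) ^ 2 * n := by exact_mod_cast key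
  rw [div_le_iff₀ (Real.sqrt_pos.2 hn0)]
  have hsq : (2 : ℝ) ^ ((n : ℝ) / 2) ≤ 16 * k.centralBinom * Real.sqrt n := by
    refine le_of_sq_le_sq ?_ (by positivity)
    rw [← Real.rpow_mul_natCast (by norm_num), mul_pow, Real.sq_sqrt hn0.le]
    norm_num
    linarith
  linarith

theorem stmt10 :
    ∃ c : ℝ, 0 < c ∧ ∃ n₀ : ℕ, ∀ n : ℕ, n₀ ≤ n →
      ∃ (m : ℕ) (δ : Fin n → Fin m → Fin n) (S : Finset (Fin n)),
        dfaTransitive δ ∧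
        (∃ w, dfaSync δ S w) ∧
        (∀ w, dfaSync δ S w →
          c * (2 : ℝ) ^ ((n : ℝ) / 2) / Real.sqrt n ≤ (w.length : ℝ)) := by
  refine ⟨1 / 16, by norm_num, 6, fun n hn => ?_⟩
  obtain ⟨k, hk, hkn, hnk⟩ : ∃ k, 1 ≤ k ∧ 4 * k + 2 ≤ n ∧ n ≤ 4 * k + 5 :=
    ⟨(n - 2) / 4, by lia, by lia, by lia⟩
  obtain ⟨B, f, hcard, hinj, hf⟩ := exists_enumeration_powersetCard (2 * k) k (by lia)
  obtain ⟨s⟩ : Nonempty (Option (Fin (2 * k)) × Bool ↪ Fin n) :=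
    Function.Embedding.nonempty_of_card_le (by simp; lia)
  have hs : ∀ p, Function.invFun s (s p) = p := Function.leftInverse_invFun s.injective
  obtain ⟨m, δ, hδ, hδ'⟩ := exists_dfa_of_maps
    (liftMaps (Function.invFun s) {g | ChainLetter ((2 * k).choose k) B f g})
  have hM : 0 < (2 * k).choose k := Nat.choose_pos (by lia)
  obtain ⟨i, hi⟩ : ∃ i, i + 1 = (2 * k).choose k := ⟨_, Nat.succ_pred_eq_of_pos hM⟩
  obtain ⟨y, hy⟩ : (B i).Nonempty := Finset.card_pos.1 (by rw [hcard]; lia)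
  obtain ⟨z, hz⟩ : ∃ z, z ∉ B i := by
    by_contra! h
    have := hcard i
    rw [Finset.eq_univ_iff_forall.2 h] at this
    simp at this
    lia
  refine ⟨m, δ, insert (s (none, false)) ((B 0).image fun x => s (some x, false)),
    dfaTransitive_of_chainLetter hs hδ' hi hy hz,
    exists_dfaSync hs hδ' hf i 0 (by lia) _ (Finset.insert_nonempty _ _) ?_, fun w hw => ?_⟩
  · intro q hq
    rcases Finset.mem_insert.1 hq with rfl | hq
    · exact Or.inl (hs _)
    · obtain ⟨x, hx, rfl⟩ := Finset.mem_image.1 hq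
      exact Or.inr ⟨x, hx, hs _⟩
  · have hlen := le_length_of_dfaSync hk hδ hcard hinj hf w _ 0 hM
      (Finset.mem_image.2 ⟨_, Finset.mem_insert_self _ _, hs _⟩)
      (fun x hx => Finset.mem_image.2
        ⟨_, Finset.mem_insert_of_mem (Finset.mem_image_of_mem _ hx), hs _⟩) hw
    refine (two_rpow_half_div_sqrt_le_centralBinom hk (by lia) hnk).trans ?_
    rw [Nat.centralBinom_eq_two_mul_choose]
    exact_mod_cast hlen.trans_eq (Nat.zero_add _)
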